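/- There exist constants δ, D > 0 such that the following holds for Thompson's group F. For all g1, g2 ∈ F with N(g1) ≥ 4 and N(g2) ≥ 4, there is a word w in the letters {x0^{±1}, x1^{±1}} of length at most D·(|g1|_A + |g2|_A) such that g1·w = g2 as elements of F, and for every prefix w' of w (evaluated as an element of F) one has |g1·w'|_A ≥ δ·min{|g1|_A, |g2|_A}. -/

import Mathlib

/-!
Formalization framework for Thompson's groups `F ≤ T ≤ V` acting on the
Cantor set `{0,1}^ℕ`.  Elements of `V` are permutations of the Cantor set
admitting a finite table of branches `u → v` (complete prefix codes) with
`g(uω) = vω`.  Products in the paper are composed left-to-right, i.e. the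
paper's `g·h` is `Equiv.trans g h` (equivalently `h * g` in `Equiv.Perm`).
-/

abbrev CSeq : Type := ℕ → Bool
abbrev VPerm : Type := Equiv.Perm CSeq

/-- Concatenation of a finite binary word with an infinite binary word. -/
def app (u : List Bool) (ω : CSeq) : CSeq := fun n =>
  if h : n < u.length then u[n] else ω (n - u.length)

/-- The finite word `u` is a prefix of the infinite word `ω`. -/
def IsPref (u : List Bool) (ω : CSeq) : Prop := ∃ ω', ω = app u ω'

/-- The finite table of branches `T` represents the permutation `g` of the
Cantor set: the domain codes and the range codes each form a complete prefix
code, and `g` maps `uω ↦ vω` for every branch `(u, v) ∈ T`. -/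
def Represents (g : VPerm) (T : Finset (List Bool × List Bool)) : Prop :=
  (∀ ω : CSeq, ∃! p : List Bool × List Bool, p ∈ T ∧ IsPref p.1 ω) ∧
  (∀ ω : CSeq, ∃! p : List Bool × List Bool, p ∈ T ∧ IsPref p.2 ω) ∧
  (∀ p ∈ T, ∀ ω : CSeq, g (app p.1 ω) = app p.2 ω)

/-- A table of branches is reduced if it contains no pair of branches
`u0 → v0`, `u1 → v1`. -/
def Reduced (T : Finset (List Bool × List Bool)) : Prop :=
  ∀ u v : List Bool,
    ¬((u ++ [false], v ++ [false]) ∈ T ∧ (u ++ [true], v ++ [true]) ∈ T)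

/-- Membership in Thompson's group `V`. -/
def InV (g : VPerm) : Prop := ∃ T, Represents g T

/-- `u → v` is a branch of the (unique) reduced representation of `g`. -/
def IsBranch (g : VPerm) (u v : List Bool) : Prop :=
  ∃ T, Represents g T ∧ Reduced T ∧ (u, v) ∈ T

/-- `N(g)`: the number of branches of the reduced representation of `g`. -/
noncomputable def Nbr (g : VPerm) : ℕ :=
  sInf {n | ∃ T, Represents g T ∧ Reduced T ∧ T.card = n}

/-- `ℓ0(g)`: the unique `ℓ ≥ 1` such that `0^ℓ` is the range code of some
branch of `g`. -/
noncomputable def ell0 (g : VPerm) : ℕ :=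
  sInf {ℓ | 1 ≤ ℓ ∧ ∃ u, IsBranch g u (List.replicate ℓ false)}

/-- `ℓ1(g)`: the unique `ℓ ≥ 1` such that `1^ℓ` is the range code of some
branch of `g`. -/
noncomputable def ell1 (g : VPerm) : ℕ :=
  sInf {ℓ | 1 ≤ ℓ ∧ ∃ u, IsBranch g u (List.replicate ℓ true)}

/-- `w` is a strict prefix of the range code of some branch of `g`. -/
def StrictPrefOfBranch (g : VPerm) (w : List Bool) : Prop :=
  ∃ u v, IsBranch g u v ∧ w <+: v ∧ w ≠ v

/-- Strict lexicographic order on infinite binary words. -/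
def lexLt (a b : CSeq) : Prop :=
  ∃ n, (∀ i < n, a i = b i) ∧ a n = false ∧ b n = true

/-- Membership in Thompson's group `F`: an element of `V` preserving the
(lexicographic) order of the Cantor set. -/
def InF (g : VPerm) : Prop :=
  InV g ∧ ∀ a b : CSeq, lexLt a b → lexLt (g a) (g b)

/-- `(a, b, c)` is a (strict) cyclically ordered triple. -/
def cyc3 (a b c : CSeq) : Prop :=
  (lexLt a b ∧ lexLt b c) ∨ (lexLt b c ∧ lexLt c a) ∨ (lexLt c a ∧ lexLt a b)

/-- Membership in Thompson's group `T`: an element of `V` preserving the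
cyclic order of the Cantor set. -/
def InT (g : VPerm) : Prop :=
  InV g ∧ ∀ a b c : CSeq, cyc3 a b c → cyc3 (g a) (g b) (g c)

/-- Word length of `g` with respect to the generating set `S` (letters are
elements of `S` or inverses of elements of `S`). -/
noncomputable def wlen (S : Set VPerm) (g : VPerm) : ℕ :=
  sInf {n | ∃ l : List VPerm,
    l.length = n ∧ (∀ x ∈ l, x ∈ S ∨ x⁻¹ ∈ S) ∧ l.prod = g}

/-- `h'` is the copy `h_{[u]}` of `h` supported on the cylinder of `u`. -/
def IsCopy (h : VPerm) (u : List Bool) (h' : VPerm) : Prop :=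
  (∀ ω : CSeq, h' (app u ω) = app u (h ω)) ∧
  (∀ ω : CSeq, ¬ IsPref u ω → h' ω = ω)

/-- Evaluation (left-to-right) of the word `w` starting at the element `g`:
the paper's product `g · w`. -/
def wordEval (g : VPerm) (w : List VPerm) : VPerm :=
  w.foldl (fun a b => a.trans b) g

/-- Branches of the generator `x0`: `00→0`, `01→10`, `1→11`. -/
def x0T : Finset (List Bool × List Bool) :=
  {([false, false], [false]), ([false, true], [true, false]),
   ([true], [true, true])}

/-- Branches of the generator `x1`: `0→0`, `100→10`, `101→110`, `11→111`. -/
def x1T : Finset (List Bool × List Bool) :=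
  {([false], [false]), ([true, false, false], [true, false]),
   ([true, false, true], [true, true, false]),
   ([true, true], [true, true, true])}

/-- Branches of the generator `c1`: `0→10`, `10→11`, `11→0`. -/
def c1T : Finset (List Bool × List Bool) :=
  {([false], [true, false]), ([true, false], [true, true]),
   ([true, true], [false])}

/-- Branches of the generator `π0`: `0→10`, `10→0`, `11→11`. -/
def pi0T : Finset (List Bool × List Bool) :=
  {([false], [true, false]), ([true, false], [false]),
   ([true, true], [true, true])}

/-- The standard generators `x_j`, `j ≥ 0`, of `F`: for `r ≥ 1`,
`x_{r+1} = x0^{-r} · x1 · x0^{r}` in the left-to-right convention of the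
paper, i.e. `x0 ^ r * x1 * (x0⁻¹) ^ r` in `Equiv.Perm`. -/
def xseq (x0 x1 : VPerm) : ℕ → VPerm
  | 0 => x0
  | r + 1 => x0 ^ r * x1 * (x0⁻¹) ^ r

/-! ### Finite and infinite binary words -/

lemma app_nil (ω : CSeq) : app [] ω = ω := by
  funext n; simp [app]

lemma app_singleton_zero (b : Bool) (ω : CSeq) : app [b] ω 0 = b := by
  simp [app]

lemma app_singleton_succ (b : Bool) (ω : CSeq) (n : ℕ) : app [b] ω (n + 1) = ω n := by
  simp [app]

lemma app_cons (b : Bool) (u : List Bool) (ω : CSeq) :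
    app (b :: u) ω = app [b] (app u ω) := by
  funext n
  cases n with
  | zero => simp [app]
  | succ n => simp [app]

lemma app_cons₂ (a b : Bool) (u : List Bool) (ω : CSeq) :
    app (a :: b :: u) ω = app [a] (app [b] (app u ω)) := by
  rw [app_cons, app_cons b u]

lemma app_append (u v : List Bool) (ω : CSeq) : app (u ++ v) ω = app u (app v ω) := by
  induction u with
  | nil => simp [app_nil]
  | cons b u ih => rw [List.cons_append, app_cons, ih, ← app_cons]

lemma exists_app_singleton (ω : CSeq) : ∃ b ω', ω = app [b] ω' :=
  ⟨ω 0, fun n => ω (n + 1), by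
    funext n
    cases n with
    | zero => rw [app_singleton_zero]
    | succ n => rw [app_singleton_succ]⟩

lemma app_singleton_inj {b c : Bool} {x y : CSeq} :
    app [b] x = app [c] y ↔ b = c ∧ x = y := by
  constructor
  · intro h
    refine ⟨by simpa [app_singleton_zero] using congrFun h 0, funext fun n => ?_⟩
    simpa [app_singleton_succ] using congrFun h (n + 1)
  · rintro ⟨rfl, rfl⟩; rfl

lemma app_inj {u : List Bool} {x y : CSeq} : app u x = app u y ↔ x = y := by
  induction u with
  | nil => simp [app_nil]
  | cons b u ih => rw [app_cons, app_cons b u y, app_singleton_inj]; simp [ih]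

/-- The infinite word `c^k ω`. -/
def powApp (c : Bool) (k : ℕ) (ω : CSeq) : CSeq := app (List.replicate k c) ω

lemma powApp_zero (c : Bool) (ω : CSeq) : powApp c 0 ω = ω := app_nil ω

lemma powApp_succ (c : Bool) (k : ℕ) (ω : CSeq) :
    powApp c (k + 1) ω = app [c] (powApp c k ω) := by
  rw [powApp, List.replicate_succ, app_cons, powApp]

lemma powApp_inj {c : Bool} {k l : ℕ} {ω : CSeq}
    (h : powApp c k (app [!c] ω) = powApp c l (app [!c] ω)) : k = l := by
  induction k generalizing l with
  | zero =>
    cases l with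
    | zero => rfl
    | succ l => simp [powApp_zero, powApp_succ, app_singleton_inj] at h
  | succ k ih =>
    cases l with
    | zero => simp [powApp_zero, powApp_succ, app_singleton_inj] at h
    | succ l =>
      rw [powApp_succ, powApp_succ, app_singleton_inj] at h
      rw [ih h.2]

/-- The constant infinite word `000…`. -/
def zeros : CSeq := fun _ => false

lemma app_false_zeros : app [false] zeros = zeros := by
  funext n
  cases n with
  | zero => rfl
  | succ n => rw [app_singleton_succ]; rfl

/-! ### The lexicographic order -/

lemma lexLt_app_singleton {b : Bool} {x y : CSeq} :
    lexLt (app [b] x) (app [b] y) ↔ lexLt x y := by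
  constructor
  · rintro ⟨n, h, h0, h1⟩
    cases n with
    | zero => simp_all [app_singleton_zero]
    | succ n =>
      rw [app_singleton_succ] at h0 h1
      refine ⟨n, fun i hi => ?_, h0, h1⟩
      simpa [app_singleton_succ] using h (i + 1) (by omega)
  · rintro ⟨n, h, h0, h1⟩
    refine ⟨n + 1, fun i hi => ?_, by rwa [app_singleton_succ], by rwa [app_singleton_succ]⟩
    cases i with
    | zero => simp [app_singleton_zero]
    | succ i => simpa [app_singleton_succ] using h i (by omega)

lemma lexLt_app_false_true (x y : CSeq) : lexLt (app [false] x) (app [true] y) :=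
  ⟨0, by simp, app_singleton_zero _ _, app_singleton_zero _ _⟩

lemma not_lexLt_app_true_false (x y : CSeq) : ¬ lexLt (app [true] x) (app [false] y) := by
  rintro ⟨n, h, h0, h1⟩
  cases n with
  | zero => simp [app_singleton_zero] at h0
  | succ n => simpa [app_singleton_zero] using h 0 (by omega)

lemma not_lexLt_zeros (x : CSeq) : ¬ lexLt x zeros := by
  rintro ⟨n, -, -, h⟩
  simp [zeros] at h

lemma eq_zeros_or_lexLt (x : CSeq) : x = zeros ∨ lexLt zeros x := by
  by_cases h : ∃ n, x n = true
  · classical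
    refine Or.inr ⟨Nat.find h, fun i hi => ?_, rfl, Nat.find_spec h⟩
    simpa [zeros] using (Nat.find_min h hi)
  · push Not at h
    exact Or.inl (funext fun n => by simpa [zeros] using h n)

/-- `g` preserves the lexicographic order. -/
def LexMono (g : VPerm) : Prop := ∀ a b : CSeq, lexLt a b → lexLt (g a) (g b)

lemma LexMono.mul {g h : VPerm} (hg : LexMono g) (hh : LexMono h) : LexMono (g * h) :=
  fun a b hab => hg _ _ (hh a b hab)

/-! ### Copies of permutations on the cylinders `[0]` and `[1]` -/

/-- The copy of `h` on `[c]`, as a map. -/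
def copyFun (c : Bool) (h : CSeq → CSeq) (ω : CSeq) : CSeq :=
  if ω 0 = c then app [c] (h fun n => ω (n + 1)) else ω

lemma copyFun_same (c : Bool) (h : CSeq → CSeq) (ω : CSeq) :
    copyFun c h (app [c] ω) = app [c] (h ω) := by
  simp [copyFun, app_singleton_zero, app_singleton_succ]

lemma copyFun_of_ne {b c : Bool} (hbc : b ≠ c) (h : CSeq → CSeq) (ω : CSeq) :
    copyFun c h (app [b] ω) = app [b] ω := by
  simp [copyFun, app_singleton_zero, hbc]

lemma copyFun_copyFun (c : Bool) (g h : CSeq → CSeq) (ω : CSeq) :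
    copyFun c g (copyFun c h ω) = copyFun c (g ∘ h) ω := by
  obtain ⟨b, ω, rfl⟩ := exists_app_singleton ω
  by_cases hbc : b = c
  · subst hbc; simp [copyFun_same]
  · simp [copyFun_of_ne hbc]

lemma copyFun_id (c : Bool) (ω : CSeq) : copyFun c id ω = ω := by
  obtain ⟨b, ω, rfl⟩ := exists_app_singleton ω
  by_cases hbc : b = c
  · subst hbc; simp [copyFun_same]
  · simp [copyFun_of_ne hbc]

/-- The copy of `h` on `[c]`, as a homomorphism. -/
def copyHom (c : Bool) : VPerm →* VPerm :=
  MonoidHom.mk' (fun h =>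
    { toFun := copyFun c h
      invFun := copyFun c h.symm
      left_inv := fun ω => by simp [copyFun_copyFun, copyFun_id]
      right_inv := fun ω => by simp [copyFun_copyFun, copyFun_id] })
    (fun g h => Equiv.ext fun ω => (copyFun_copyFun c g h ω).symm)

lemma copyHom_same (c : Bool) (h : VPerm) (ω : CSeq) :
    copyHom c h (app [c] ω) = app [c] (h ω) := copyFun_same c h ω

lemma copyHom_of_ne {b c : Bool} (hbc : b ≠ c) (h : VPerm) (ω : CSeq) :
    copyHom c h (app [b] ω) = app [b] ω := copyFun_of_ne hbc h ω

lemma LexMono.copyHom {g : VPerm} (hg : LexMono g) (c : Bool) : LexMono (copyHom c g) := by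
  intro a b hab
  obtain ⟨i, a, rfl⟩ := exists_app_singleton a
  obtain ⟨j, b, rfl⟩ := exists_app_singleton b
  cases i <;> cases j <;> cases c <;>
    simp_all [copyHom_same, copyHom_of_ne, lexLt_app_singleton, lexLt_app_false_true,
      not_lexLt_app_true_false] <;> exact hg _ _ hab

/-! ### The generators -/

/-- The prefix replacement rules of the two generators of Thompson's group `F`. -/
structure IsGenPair (x0 x1 : VPerm) : Prop where
  x0_00 : ∀ ω, x0 (app [false] (app [false] ω)) = app [false] ω
  x0_01 : ∀ ω, x0 (app [false] (app [true] ω)) = app [true] (app [false] ω)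
  x0_1 : ∀ ω, x0 (app [true] ω) = app [true] (app [true] ω)
  x1_eq : x1 = copyHom true x0

lemma inv_apply_of_apply_eq {g : VPerm} {a b : CSeq} (h : g a = b) : g⁻¹ b = a := by
  rw [Equiv.Perm.inv_def, ← h, Equiv.symm_apply_apply]

lemma isGenPair_of_represents {x0 x1 : VPerm} (hx0 : Represents x0 x0T)
    (hx1 : Represents x1 x1T) : IsGenPair x0 x1 := by
  have h00 := hx0.2.2 ([false, false], [false]) (by simp [x0T])
  have h01 := hx0.2.2 ([false, true], [true, false]) (by simp [x0T])
  have h1 := hx0.2.2 ([true], [true, true]) (by simp [x0T])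
  have k0 := hx1.2.2 ([false], [false]) (by simp [x1T])
  have k100 := hx1.2.2 ([true, false, false], [true, false]) (by simp [x1T])
  have k101 := hx1.2.2 ([true, false, true], [true, true, false]) (by simp [x1T])
  have k11 := hx1.2.2 ([true, true], [true, true, true]) (by simp [x1T])
  have e2 : ∀ a b ω, app [a, b] ω = app [a] (app [b] ω) := fun a b ω => app_cons a [b] ω
  have e3 : ∀ a b c ω, app [a, b, c] ω = app [a] (app [b] (app [c] ω)) := fun a b c ω => by
    rw [app_cons, e2]
  simp only [e2, e3] at h00 h01 h1 k0 k100 k101 k11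
  refine ⟨h00, h01, h1, Equiv.ext fun ω => ?_⟩
  obtain ⟨a, ω, rfl⟩ := exists_app_singleton ω
  cases a
  · rw [k0, copyHom_of_ne (by decide)]
  rw [copyHom_same]
  obtain ⟨a, ω, rfl⟩ := exists_app_singleton ω
  cases a
  · obtain ⟨a, ω, rfl⟩ := exists_app_singleton ω
    cases a
    · rw [k100, h00]
    · rw [k101, h01]
  · rw [k11, h1]

namespace IsGenPair

variable {x0 x1 : VPerm}

lemma x0_inv_0 (hx : IsGenPair x0 x1) (ω : CSeq) :
    x0⁻¹ (app [false] ω) = app [false] (app [false] ω) :=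
  inv_apply_of_apply_eq (hx.x0_00 ω)

lemma x0_inv_10 (hx : IsGenPair x0 x1) (ω : CSeq) :
    x0⁻¹ (app [true] (app [false] ω)) = app [false] (app [true] ω) :=
  inv_apply_of_apply_eq (hx.x0_01 ω)

lemma x0_inv_11 (hx : IsGenPair x0 x1) (ω : CSeq) :
    x0⁻¹ (app [true] (app [true] ω)) = app [true] ω :=
  inv_apply_of_apply_eq (hx.x0_1 ω)

lemma x1_0 (hx : IsGenPair x0 x1) (ω : CSeq) : x1 (app [false] ω) = app [false] ω := by
  rw [hx.x1_eq, copyHom_of_ne (by decide)]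

lemma x1_1 (hx : IsGenPair x0 x1) (ω : CSeq) : x1 (app [true] ω) = app [true] (x0 ω) := by
  rw [hx.x1_eq, copyHom_same]

lemma x1_inv_0 (hx : IsGenPair x0 x1) (ω : CSeq) : x1⁻¹ (app [false] ω) = app [false] ω :=
  inv_apply_of_apply_eq (hx.x1_0 ω)

lemma x1_inv_1 (hx : IsGenPair x0 x1) (ω : CSeq) :
    x1⁻¹ (app [true] ω) = app [true] (x0⁻¹ ω) :=
  inv_apply_of_apply_eq (by rw [hx.x1_1, Equiv.Perm.inv_def, Equiv.apply_symm_apply])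

lemma lexMono_x0 (hx : IsGenPair x0 x1) : LexMono x0 := by
  intro a b hab
  obtain ⟨i, a, rfl⟩ := exists_app_singleton a
  obtain ⟨i', a, rfl⟩ := exists_app_singleton a
  obtain ⟨j, b, rfl⟩ := exists_app_singleton b
  obtain ⟨j', b, rfl⟩ := exists_app_singleton b
  cases i <;> cases j <;> cases i' <;> cases j' <;>
    simp_all [hx.x0_00, hx.x0_01, hx.x0_1, lexLt_app_singleton, lexLt_app_false_true,
      not_lexLt_app_true_false]

lemma lexMono_x0_inv (hx : IsGenPair x0 x1) : LexMono x0⁻¹ := by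
  intro a b hab
  obtain ⟨i, a, rfl⟩ := exists_app_singleton a
  obtain ⟨i', a, rfl⟩ := exists_app_singleton a
  obtain ⟨j, b, rfl⟩ := exists_app_singleton b
  obtain ⟨j', b, rfl⟩ := exists_app_singleton b
  cases i <;> cases j <;> cases i' <;> cases j' <;>
    simp_all [hx.x0_inv_0, hx.x0_inv_10, hx.x0_inv_11, lexLt_app_singleton,
      lexLt_app_false_true, not_lexLt_app_true_false]

/-! ### The group generated by `x0` and `x1` contains `F` -/

lemma x0_mem : x0 ∈ Subgroup.closure ({x0, x1} : Set VPerm) :=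
  Subgroup.subset_closure (by simp)

lemma x1_mem : x1 ∈ Subgroup.closure ({x0, x1} : Set VPerm) :=
  Subgroup.subset_closure (by simp)

lemma copyHom_false_x0 (hx : IsGenPair x0 x1) :
    copyHom false x0 = x0⁻¹ * x1⁻¹ * x0 * x0 := by
  ext1 ω
  simp only [Equiv.Perm.mul_apply]
  obtain ⟨a, ω, rfl⟩ := exists_app_singleton ω
  cases a
  · rw [copyHom_same]
    obtain ⟨a, ω, rfl⟩ := exists_app_singleton ω
    cases a
    · obtain ⟨a, ω, rfl⟩ := exists_app_singleton ω
      cases a <;> simp [hx.x0_00, hx.x0_01, hx.x1_inv_0, hx.x1_inv_1, hx.x0_inv_0, hx.x0_inv_10]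
    · simp [hx.x0_01, hx.x0_1, hx.x1_inv_1, hx.x0_inv_10]
  · rw [copyHom_of_ne (by decide), hx.x0_1, hx.x0_1, hx.x1_inv_1, hx.x0_inv_11, hx.x0_inv_11]

lemma copyHom_true_x1 (hx : IsGenPair x0 x1) : copyHom true x1 = x0 * x1 * x0⁻¹ := by
  ext1 ω
  simp only [Equiv.Perm.mul_apply]
  obtain ⟨a, ω, rfl⟩ := exists_app_singleton ω
  cases a
  · rw [copyHom_of_ne (by decide), hx.x0_inv_0, hx.x1_0, hx.x0_00]
  · rw [copyHom_same]
    obtain ⟨a, ω, rfl⟩ := exists_app_singleton ω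
    cases a
    · rw [hx.x0_inv_10, hx.x1_0, hx.x1_0, hx.x0_01]
    · rw [hx.x0_inv_11, hx.x1_1, hx.x0_1]

lemma copyHom_false_x1 (hx : IsGenPair x0 x1) :
    copyHom false x1 = x0⁻¹ * copyHom true (copyHom false x0) * x0 := by
  ext1 ω
  simp only [Equiv.Perm.mul_apply]
  obtain ⟨a, ω, rfl⟩ := exists_app_singleton ω
  cases a
  · rw [copyHom_same]
    obtain ⟨a, ω, rfl⟩ := exists_app_singleton ω
    cases a
    · rw [hx.x1_0, hx.x0_00, copyHom_of_ne (by decide), hx.x0_inv_0]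
    · rw [hx.x1_1, hx.x0_01, copyHom_same, copyHom_same, hx.x0_inv_10]
  · rw [copyHom_of_ne (by decide), hx.x0_1, copyHom_same, copyHom_of_ne (by decide),
      hx.x0_inv_11]

lemma copyHom_true_mem (hx : IsGenPair x0 x1) {h : VPerm}
    (hh : h ∈ Subgroup.closure ({x0, x1} : Set VPerm)) :
    copyHom true h ∈ Subgroup.closure ({x0, x1} : Set VPerm) := by
  suffices Subgroup.closure ({x0, x1} : Set VPerm) ≤
      (Subgroup.closure {x0, x1}).comap (copyHom true) from this hh
  rw [Subgroup.closure_le]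
  rintro x (rfl | rfl)
  · rw [SetLike.mem_coe, Subgroup.mem_comap, ← hx.x1_eq]
    exact x1_mem
  · rw [SetLike.mem_coe, Subgroup.mem_comap, hx.copyHom_true_x1]
    exact mul_mem (mul_mem x0_mem x1_mem) (inv_mem x0_mem)

lemma copyHom_false_x0_mem (hx : IsGenPair x0 x1) :
    copyHom false x0 ∈ Subgroup.closure ({x0, x1} : Set VPerm) := by
  rw [hx.copyHom_false_x0]
  exact mul_mem (mul_mem (mul_mem (inv_mem x0_mem) (inv_mem x1_mem)) x0_mem) x0_mem

lemma copyHom_mem (hx : IsGenPair x0 x1) (c : Bool) {h : VPerm}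
    (hh : h ∈ Subgroup.closure ({x0, x1} : Set VPerm)) :
    copyHom c h ∈ Subgroup.closure ({x0, x1} : Set VPerm) := by
  cases c
  · suffices Subgroup.closure ({x0, x1} : Set VPerm) ≤
        (Subgroup.closure {x0, x1}).comap (copyHom false) from this hh
    rw [Subgroup.closure_le]
    rintro x (rfl | rfl)
    · exact hx.copyHom_false_x0_mem
    · rw [SetLike.mem_coe, Subgroup.mem_comap, hx.copyHom_false_x1]
      exact mul_mem (mul_mem (inv_mem x0_mem) (hx.copyHom_true_mem hx.copyHom_false_x0_mem))
        x0_mem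
  · exact hx.copyHom_true_mem hh

end IsGenPair

/-- `g` acts on the cylinder of `u` by replacing the prefix `u`. -/
def ActsOnCylinder (g : VPerm) (u : List Bool) : Prop :=
  ∃ v : List Bool, ∀ ω, g (app u ω) = app v ω

/-- An element that acts on all cylinders not containing `[w]` by replacing prefixes, and that
moves the midpoint of `[w]` to the midpoint of the Cantor set. -/
structure Centers (h : VPerm) (w : List Bool) : Prop where
  lexMono : LexMono h
  map_mid : h (app w (app [true] zeros)) = app [true] zeros
  acts : ∀ u, ¬ u <+: w → ∃ v : List Bool, v ≠ [] ∧ ∀ ω, h (app u ω) = app v ω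

lemma IsGenPair.exists_centers {x0 x1 : VPerm} (hx : IsGenPair x0 x1) (w : List Bool) :
    ∃ h ∈ Subgroup.closure ({x0, x1} : Set VPerm), Centers h w := by
  induction w with
  | nil =>
    exact ⟨1, one_mem _, fun a b hab => hab, rfl, fun u hu => ⟨u, by simpa using hu, fun _ => rfl⟩⟩
  | cons c w ih =>
    obtain ⟨h, hh, hm, hw, ha⟩ := ih
    have key : ∀ y : VPerm, LexMono y → y ∈ Subgroup.closure ({x0, x1} : Set VPerm) →
        y (app [c] (app [true] zeros)) = app [true] zeros →
        (∀ u, ∃ v : List Bool, v ≠ [] ∧ ∀ ω, y (app ((!c) :: u) ω) = app v ω) →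
        (∀ a u, ∃ v : List Bool, v ≠ [] ∧ ∀ ω, y (app (c :: a :: u) ω) = app v ω) →
        ∃ h ∈ Subgroup.closure ({x0, x1} : Set VPerm), Centers h (c :: w) := by
      intro y hy hyH hmid h1 h2
      refine ⟨y * copyHom c h, mul_mem hyH (hx.copyHom_mem c hh), hy.mul (hm.copyHom c), ?_, ?_⟩
      · rw [Equiv.Perm.mul_apply, app_cons, copyHom_same, hw, hmid]
      · intro u hu
        cases u with
        | nil => simp at hu
        | cons b u =>
          by_cases hb : b = c
          · subst hb
            obtain ⟨v, hv, hv'⟩ := ha u (by simpa using hu)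
            cases v with
            | nil => exact absurd rfl hv
            | cons a v =>
              obtain ⟨v', hv1, hv2⟩ := h2 a v
              refine ⟨v', hv1, fun ω => ?_⟩
              rw [Equiv.Perm.mul_apply, app_cons, copyHom_same, hv', ← app_cons, hv2]
          · obtain rfl : b = !c := by cases b <;> cases c <;> simp_all
            obtain ⟨v', hv1, hv2⟩ := h1 u
            refine ⟨v', hv1, fun ω => ?_⟩
            rw [Equiv.Perm.mul_apply, app_cons, copyHom_of_ne hb, ← app_cons, hv2]
    cases c
    · refine key x0 hx.lexMono_x0 IsGenPair.x0_mem ?_ (fun u => ⟨true :: true :: u, by simp,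
        fun ω => ?_⟩) fun a u => ?_
      · rw [hx.x0_01, app_false_zeros]
      · rw [Bool.not_false, app_cons true u, hx.x0_1, app_cons₂]
      · cases a
        · exact ⟨false :: u, by simp, fun ω => by rw [app_cons₂, hx.x0_00, ← app_cons]⟩
        · exact ⟨true :: false :: u, by simp, fun ω => by rw [app_cons₂, hx.x0_01, app_cons₂]⟩
    · refine key x0⁻¹ hx.lexMono_x0_inv (inv_mem IsGenPair.x0_mem) ?_ (fun u =>
        ⟨false :: false :: u, by simp, fun ω => ?_⟩) fun a u => ?_
      · rw [hx.x0_inv_11]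
      · rw [Bool.not_true, app_cons false u, hx.x0_inv_0, app_cons₂]
      · cases a
        · exact ⟨false :: true :: u, by simp, fun ω => by
            rw [app_cons₂, hx.x0_inv_10, app_cons₂]⟩
        · exact ⟨true :: u, by simp, fun ω => by rw [app_cons₂, hx.x0_inv_11, ← app_cons]⟩

lemma exists_eq_app_true_zeros {v : List Bool} {ω : CSeq} (hv : app v zeros = ω)
    (hω : ω ≠ zeros) : ∃ w, ω = app w (app [true] zeros) := by
  subst hv
  induction v with
  | nil => exact absurd (app_nil _) hω
  | cons b v ih =>
    by_cases h : app v zeros = zeros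
    · rw [app_cons, h] at hω ⊢
      cases b
      · exact absurd app_false_zeros hω
      · exact ⟨[], (app_nil _).symm⟩
    · obtain ⟨w, hw⟩ := ih h
      exact ⟨b :: w, by rw [app_cons, hw, ← app_cons]⟩

lemma eq_zeros_of_app_eq_zeros {u : List Bool} {y : CSeq} (h : app u y = zeros) :
    y = zeros := by
  induction u with
  | nil => rwa [app_nil] at h
  | cons b u ih =>
    rw [app_cons, ← app_false_zeros, app_singleton_inj] at h
    exact ih h.2

lemma exists_preserves_first (g : VPerm) (hg : ∀ c ω, ∃ ω', g (app [c] ω) = app [c] ω') :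
    ∃ k : Bool → VPerm, ∀ c ω, g (app [c] ω) = app [c] (k c ω) := by
  choose f hf using hg
  refine ⟨fun c => Equiv.ofBijective (f c) ⟨fun a b hab => ?_, fun b => ?_⟩, hf⟩
  · have : g (app [c] a) = g (app [c] b) := by rw [hf, hf, hab]
    exact app_inj.1 (g.injective this)
  · obtain ⟨a, ha⟩ := g.surjective (app [c] b)
    obtain ⟨c', a, rfl⟩ := exists_app_singleton a
    rw [hf, app_singleton_inj] at ha
    obtain ⟨rfl, ha⟩ := ha
    exact ⟨a, ha⟩

lemma LexMono.preserves_first {g : VPerm} (hg : LexMono g)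
    (hmid : g (app [true] zeros) = app [true] zeros) (c : Bool) (ω : CSeq) :
    ∃ ω', g (app [c] ω) = app [c] ω' := by
  obtain ⟨d, ω', hω'⟩ := exists_app_singleton (g (app [c] ω))
  rw [hω']
  cases c
  · have h := hg _ _ (lexLt_app_false_true ω zeros)
    rw [hmid, hω'] at h
    cases d
    · exact ⟨_, rfl⟩
    · rw [lexLt_app_singleton] at h
      exact absurd h (not_lexLt_zeros _)
  · rcases eq_zeros_or_lexLt ω with rfl | h
    · exact ⟨zeros, by rw [← hω', hmid]⟩
    · have h := hg _ _ (lexLt_app_singleton (b := true).2 h)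
      rw [hmid, hω'] at h
      cases d
      · exact absurd h (not_lexLt_app_true_false _ _)
      · exact ⟨_, rfl⟩

lemma IsGenPair.mem_closure {x0 x1 : VPerm} (hx : IsGenPair x0 x1) (d : ℕ) (g : VPerm)
    (hg : LexMono g) (hd : ∀ u : List Bool, u.length = d → ActsOnCylinder g u) :
    g ∈ Subgroup.closure ({x0, x1} : Set VPerm) := by
  induction d generalizing g with
  | zero =>
    obtain ⟨v, hv⟩ := hd [] rfl
    simp only [app_nil] at hv
    cases v with
    | nil =>
      convert one_mem (Subgroup.closure ({x0, x1} : Set VPerm))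
      exact Equiv.ext fun ω => by rw [hv, app_nil]; rfl
    | cons b v =>
      obtain ⟨ω, hω⟩ := g.surjective (app [!b] zeros)
      rw [hv, app_cons, app_singleton_inj] at hω
      simp at hω
  | succ d ih =>
    have hne : g (app [true] zeros) ≠ zeros := by
      intro h
      have := hg _ _ (lexLt_app_false_true zeros zeros)
      rw [h] at this
      exact not_lexLt_zeros _ this
    obtain ⟨w, hw⟩ : ∃ w, g (app [true] zeros) = app w (app [true] zeros) := by
      obtain ⟨v, hv⟩ := hd (true :: List.replicate d false) (by simp)
      refine exists_eq_app_true_zeros (v := v) ?_ hne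
      rw [← hv, app_cons]
      congr 2
      clear * -
      induction d with
      | zero => exact app_nil _
      | succ d ih => rw [List.replicate_succ, app_cons, ih, app_false_zeros]
    obtain ⟨h, hh, hm, hmid, ha⟩ := hx.exists_centers w
    suffices h * g ∈ Subgroup.closure ({x0, x1} : Set VPerm) by
      simpa using mul_mem (inv_mem hh) this
    have hhg : LexMono (h * g) := hm.mul hg
    obtain ⟨k, hk⟩ := exists_preserves_first (h * g)
      (hhg.preserves_first (by rw [Equiv.Perm.mul_apply, hw, hmid]))
    have hkmem : ∀ c, k c ∈ Subgroup.closure ({x0, x1} : Set VPerm) := by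
      intro c
      refine ih (k c) (fun a b hab => ?_) fun u hu => ?_
      · have := hhg _ _ (lexLt_app_singleton (b := c).2 hab)
        rwa [hk, hk, lexLt_app_singleton] at this
      · obtain ⟨v, hv⟩ := hd (c :: u) (by simp [hu])
        obtain ⟨v', hv', hv2⟩ := ha v (by
          rintro ⟨z, rfl⟩
          rw [app_append, ← hv] at hw
          have h1 := g.injective hw
          rw [app_cons c, app_singleton_inj] at h1
          have h2 := eq_zeros_of_app_eq_zeros (eq_zeros_of_app_eq_zeros h1.2.symm)
          rw [← app_false_zeros, app_singleton_inj] at h2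
          simp at h2)
        cases v' with
        | nil => exact absurd rfl hv'
        | cons b v' =>
          refine ⟨v', fun ω => ?_⟩
          have h1 := hk c (app u ω)
          rw [Equiv.Perm.mul_apply, ← app_cons, hv, hv2, app_cons, app_singleton_inj] at h1
          exact h1.2.symm
    have hfac : h * g = copyHom false (k false) * copyHom true (k true) := by
      refine Equiv.ext fun ω => ?_
      obtain ⟨c, ω, rfl⟩ := exists_app_singleton ω
      rw [hk, Equiv.Perm.mul_apply]
      cases c
      · rw [copyHom_of_ne (by decide), copyHom_same]
      · rw [copyHom_same, copyHom_of_ne (by decide)]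
    rw [hfac]
    exact mul_mem (hx.copyHom_mem _ (hkmem _)) (hx.copyHom_mem _ (hkmem _))

lemma prefix_of_app_eq_app {p u : List Bool} {x y : CSeq} (h : app p x = app u y)
    (hl : p.length ≤ u.length) : p <+: u := by
  induction p generalizing u with
  | nil => simp
  | cons a p ih =>
    cases u with
    | nil => simp at hl
    | cons b u =>
      rw [app_cons, app_cons b, app_singleton_inj] at h
      obtain ⟨rfl, h⟩ := h
      simpa using ih h (by simpa using hl)

lemma exists_depth_of_inV {g : VPerm} (hg : InV g) :
    ∃ d, ∀ u : List Bool, u.length = d → ActsOnCylinder g u := by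
  obtain ⟨T, h1, -, h3⟩ := hg
  refine ⟨T.sup fun p => p.1.length, fun u hu => ?_⟩
  obtain ⟨p, ⟨hp, x, hx⟩, -⟩ := h1 (app u zeros)
  obtain ⟨z, rfl⟩ := prefix_of_app_eq_app hx.symm
    (hu ▸ Finset.le_sup (f := fun p : List Bool × List Bool => p.1.length) hp)
  exact ⟨p.2 ++ z, fun ω => by rw [app_append, h3 p hp, app_append]⟩

lemma IsGenPair.mem_closure_of_inF {x0 x1 g : VPerm} (hx : IsGenPair x0 x1) (hg : InF g) :
    g ∈ Subgroup.closure ({x0, x1} : Set VPerm) := by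
  obtain ⟨d, hd⟩ := exists_depth_of_inV hg.1
  exact hx.mem_closure d g hg.2 hd

/-! ### Word length -/

section WordLength

variable {S : Set VPerm}

lemma wlen_prod_le {l : List VPerm} (hl : ∀ x ∈ l, x ∈ S ∨ x⁻¹ ∈ S) :
    wlen S l.prod ≤ l.length :=
  Nat.sInf_le ⟨l, rfl, hl, rfl⟩

lemma exists_word {g : VPerm} (hg : g ∈ Subgroup.closure S) :
    ∃ l : List VPerm, l.length = wlen S g ∧ (∀ x ∈ l, x ∈ S ∨ x⁻¹ ∈ S) ∧ l.prod = g := by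
  rw [← Subgroup.mem_toSubmonoid, Subgroup.closure_toSubmonoid] at hg
  obtain ⟨l, hl, hg⟩ := Submonoid.exists_list_of_mem_closure hg
  exact Nat.sInf_mem
    (s := {n | ∃ l : List VPerm, l.length = n ∧ (∀ x ∈ l, x ∈ S ∨ x⁻¹ ∈ S) ∧ l.prod = g})
    ⟨l.length, l, rfl, hl, hg⟩

lemma prod_mem_closure {l : List VPerm} (hl : ∀ x ∈ l, x ∈ S ∨ x⁻¹ ∈ S) :
    l.prod ∈ Subgroup.closure S := by
  refine list_prod_mem fun x hx => ?_
  rcases hl x hx with h | h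
  · exact Subgroup.subset_closure h
  · exact inv_mem_iff.1 (Subgroup.subset_closure h)

lemma wlen_one : wlen S 1 = 0 := by
  simpa using wlen_prod_le (S := S) (l := []) (by simp)

lemma wlen_le_one {x : VPerm} (hx : x ∈ S ∨ x⁻¹ ∈ S) : wlen S x ≤ 1 := by
  simpa using wlen_prod_le (S := S) (l := [x]) (by simpa using hx)

lemma eq_one_of_wlen_eq_zero {g : VPerm} (hg : g ∈ Subgroup.closure S) (h : wlen S g = 0) :
    g = 1 := by
  obtain ⟨l, hl, -, rfl⟩ := exists_word hg
  rw [h, List.length_eq_zero_iff] at hl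
  rw [hl, List.prod_nil]

lemma wlen_mul_le {g h : VPerm} (hg : g ∈ Subgroup.closure S) (hh : h ∈ Subgroup.closure S) :
    wlen S (g * h) ≤ wlen S g + wlen S h := by
  obtain ⟨l, hl, hlS, rfl⟩ := exists_word hg
  obtain ⟨m, hm, hmS, rfl⟩ := exists_word hh
  rw [← hl, ← hm, ← List.prod_append, ← List.length_append]
  exact wlen_prod_le fun x hx => (List.mem_append.1 hx).elim (hlS x) (hmS x)

lemma wlen_inv_le {g : VPerm} (hg : g ∈ Subgroup.closure S) : wlen S g⁻¹ ≤ wlen S g := by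
  obtain ⟨l, hl, hlS, rfl⟩ := exists_word hg
  rw [← hl, List.prod_inv_reverse]
  refine (wlen_prod_le ?_).trans (by simp)
  intro x hx
  obtain ⟨y, hy, rfl⟩ := List.mem_map.1 (List.mem_reverse.1 hx)
  rw [inv_inv]
  exact (hlS y hy).symm

lemma wlen_inv {g : VPerm} (hg : g ∈ Subgroup.closure S) : wlen S g⁻¹ = wlen S g :=
  (wlen_inv_le hg).antisymm (by simpa using wlen_inv_le (inv_mem hg))

lemma wlen_le_add_mul {u g : VPerm} (hu : u ∈ Subgroup.closure S)
    (hg : g ∈ Subgroup.closure S) : wlen S g ≤ wlen S u + wlen S (u * g) := by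
  have := wlen_mul_le (inv_mem hu) (mul_mem hu hg)
  rwa [inv_mul_cancel_left, wlen_inv hu] at this

lemma wlen_le_mul_add {u g : VPerm} (hu : u ∈ Subgroup.closure S)
    (hg : g ∈ Subgroup.closure S) : wlen S u ≤ wlen S (u * g) + wlen S g := by
  have := wlen_mul_le (mul_mem hu hg) (inv_mem hg)
  rwa [mul_inv_cancel_right, wlen_inv hg] at this

lemma wlen_pow_le {z : VPerm} (hz : z ∈ Subgroup.closure S) (m : ℕ) :
    wlen S (z ^ m) ≤ m * wlen S z := by
  induction m with
  | zero => simp [wlen_one]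
  | succ m ih =>
    rw [pow_succ, Nat.succ_mul]
    exact (wlen_mul_le (pow_mem hz m) hz).trans (by omega)

/-! ### Paths avoiding a ball -/

/-- There is a path of length at most `L` from `g` to `h` in the Cayley graph of `S`
(multiplication by letters on the left) along which `9 * wlen S` is at least `r`. -/
inductive FarPath (S : Set VPerm) (r : ℕ) : ℕ → VPerm → VPerm → Prop
  | refl (L : ℕ) (g : VPerm) : r ≤ 9 * wlen S g → FarPath S r L g g
  | step (L : ℕ) (x g h : VPerm) : r ≤ 9 * wlen S g → x ∈ S ∨ x⁻¹ ∈ S →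
      FarPath S r L (x * g) h → FarPath S r (L + 1) g h

namespace FarPath

variable {r L L' : ℕ} {g h k : VPerm}

lemma mono (p : FarPath S r L g h) (hL : L ≤ L') : FarPath S r L' g h := by
  induction p generalizing L' with
  | refl L g hr => exact refl _ _ hr
  | step L x g h hr hx _ ih =>
    obtain ⟨L', rfl⟩ := Nat.exists_eq_succ_of_ne_zero (show L' ≠ 0 by omega)
    exact step _ x _ _ hr hx (ih (by omega))

lemma trans (p : FarPath S r L g h) (q : FarPath S r L' h k) : FarPath S r (L + L') g k := by
  induction p with
  | refl L g hr => exact q.mono (by omega)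
  | step L x g h hr hx _ ih =>
    rw [Nat.add_right_comm]
    exact step _ x _ _ hr hx (ih q)

lemma source_le (p : FarPath S r L g h) : r ≤ 9 * wlen S g := by
  cases p <;> assumption

lemma symm (p : FarPath S r L g h) : FarPath S r L h g := by
  induction p with
  | refl L g hr => exact refl _ _ hr
  | step L x g h hr hx q ih =>
    refine ih.trans (step 0 x⁻¹ _ _ q.source_le (by rwa [inv_inv, or_comm]) ?_)
    rw [inv_mul_cancel_left]
    exact refl _ _ hr

lemma exists_word (p : FarPath S r L g h) :
    ∃ w : List VPerm, (∀ x ∈ w, x ∈ S ∨ x⁻¹ ∈ S) ∧ w.length ≤ L ∧ wordEval g w = h ∧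
      ∀ w' : List VPerm, w' <+: w → r ≤ 9 * wlen S (wordEval g w') := by
  induction p with
  | refl L g hr => exact ⟨[], by simp, by simp, rfl, fun w' hw' => by
      rw [List.prefix_nil.1 hw']; exact hr⟩
  | step L x g h hr hx q ih =>
    obtain ⟨w, hw, hl, he, hp⟩ := ih
    refine ⟨x :: w, by simpa using ⟨hx, hw⟩, by simpa using hl, he, fun w' hw' => ?_⟩
    cases w' with
    | nil => exact hr
    | cons y w' =>
      obtain ⟨rfl, hw''⟩ := List.cons_prefix_cons.1 hw'
      exact hp w' hw''

lemma prod {l : List VPerm} (hl : ∀ x ∈ l, x ∈ S ∨ x⁻¹ ∈ S) (hg : g ∈ Subgroup.closure S)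
    (hr : r + 9 * l.length ≤ 9 * wlen S g) : FarPath S r l.length g (l.prod * g) := by
  induction l with
  | nil => simpa using refl 0 g (by simpa using hr)
  | cons x l ih =>
    simp only [List.mem_cons, forall_eq_or_imp, List.length_cons] at hl hr
    have hlm := prod_mem_closure hl.2
    have hxl : ∀ y ∈ x :: l, y ∈ S ∨ y⁻¹ ∈ S := by simpa using hl
    have h1 := wlen_le_add_mul hlm hg
    have h2 := wlen_le_add_mul (prod_mem_closure hxl) hg
    have h3 := wlen_prod_le hl.2
    have h4 := wlen_prod_le hxl
    rw [List.length_cons] at h4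
    refine (ih hl.2 (by omega)).trans (step 0 x _ _ (by omega) hl.1 ?_)
    rw [← mul_assoc, ← List.prod_cons]
    exact refl _ _ (by omega)

lemma mul {u : VPerm} (hu : u ∈ Subgroup.closure S) (hg : g ∈ Subgroup.closure S)
    (hr : r + 9 * wlen S u ≤ 9 * wlen S g) : FarPath S r (wlen S u) g (u * g) := by
  obtain ⟨l, hl, hlS, rfl⟩ := _root_.exists_word hu
  rw [← hl] at hr ⊢
  exact prod hlS hg hr

lemma iterate {z : VPerm} (m : ℕ)
    (hz : ∀ i < m, FarPath S r L (z ^ i * g) (z ^ (i + 1) * g)) (hg : r ≤ 9 * wlen S g) :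
    FarPath S r (m * L) g (z ^ m * g) := by
  induction m with
  | zero => simpa using refl _ _ hg
  | succ m ih =>
    rw [Nat.succ_mul]
    exact (ih fun i hi => hz i (by omega)).trans (hz m (by omega))

end FarPath

/-- An undistorted element of the group generated by `S`. -/
structure Undistorted (S : Set VPerm) (z : VPerm) : Prop where
  mem : z ∈ Subgroup.closure S
  wlen_le : wlen S z ≤ 4
  le_wlen_pow : ∀ i : ℕ, i ≤ wlen S (z ^ i)

namespace Undistorted

variable {z g : VPerm} {r : ℕ}

lemma inv (hz : Undistorted S z) : Undistorted S z⁻¹ where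
  mem := inv_mem hz.mem
  wlen_le := by rw [wlen_inv hz.mem]; exact hz.wlen_le
  le_wlen_pow i := by rw [inv_pow, wlen_inv (pow_mem hz.mem i)]; exact hz.le_wlen_pow i

lemma wlen_pow_le (hz : Undistorted S z) (m : ℕ) : wlen S (z ^ m) ≤ m * 4 :=
  (_root_.wlen_pow_le hz.mem m).trans (Nat.mul_le_mul_left m hz.wlen_le)

/-- One of the two rays through `g` in the direction of `z` stays far from the identity. -/
lemma far_or_far (hz : Undistorted S z) (hg : g ∈ Subgroup.closure S) :
    (∀ i : ℕ, wlen S g ≤ 9 * wlen S (z ^ i * g)) ∨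
      ∀ i : ℕ, wlen S g ≤ 9 * wlen S (z⁻¹ ^ i * g) := by
  by_contra! h
  obtain ⟨⟨i, hi⟩, j, hj⟩ := h
  have h1 := hz.le_wlen_pow (i + j)
  have hzi := pow_mem hz.mem i
  have hzj := pow_mem hz.inv.mem j
  have h2 := wlen_mul_le (mul_mem hzi hg) (inv_mem (mul_mem hzj hg))
  rw [wlen_inv (mul_mem hzj hg), show z ^ i * g * (z⁻¹ ^ j * g)⁻¹ = z ^ (i + j) by
    rw [pow_add]; group] at h2
  have h3 := wlen_le_add_mul hzi hg
  have h4 := hz.wlen_pow_le i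
  omega

lemma farPath_pow (hz : Undistorted S z) (hg : g ∈ Subgroup.closure S) (m : ℕ)
    (h : ∀ i : ℕ, r + 36 ≤ 9 * wlen S (z ^ i * g)) : FarPath S r (m * 4) g (z ^ m * g) := by
  refine FarPath.iterate m (fun i _ => ?_) (by have := h 0; simp at this; omega)
  rw [pow_succ', mul_assoc]
  have := hz.wlen_le
  have := h i
  exact (FarPath.mul hz.mem (mul_mem (pow_mem hz.mem i) hg) (by omega)).mono hz.wlen_le

lemma farPath_pow_of_letter (hz : z ∈ S ∨ z⁻¹ ∈ S) (m : ℕ)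
    (h : ∀ i : ℕ, r ≤ 9 * wlen S (z ^ i * g)) : FarPath S r m g (z ^ m * g) := by
  refine (FarPath.iterate (L := 1) m (fun i _ => ?_) (by simpa using h 0)).mono (mul_one m).le
  rw [pow_succ', mul_assoc]
  refine FarPath.step 0 z _ _ (h i) hz (FarPath.refl _ _ ?_)
  rw [← mul_assoc, ← pow_succ']
  exact h (i + 1)

/-- Any `g` can be joined to a conjugate by `g` of a large power of `z`. -/
lemma farPath_conj (hz : Undistorted S z) (hg : g ∈ Subgroup.closure S) {m : ℕ}
    (h : r + 36 ≤ wlen S g) (hm : r + 2 * wlen S g ≤ m) :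
    ∃ ζ, (ζ = z ∨ ζ = z⁻¹) ∧ FarPath S r (m * 4 + wlen S g) g (g⁻¹ * (ζ ^ m * g)) := by
  obtain ⟨ζ, hζ, hζ', hf⟩ : ∃ ζ, (ζ = z ∨ ζ = z⁻¹) ∧ Undistorted S ζ ∧
      ∀ i : ℕ, wlen S g ≤ 9 * wlen S (ζ ^ i * g) := by
    rcases hz.far_or_far hg with hf | hf
    · exact ⟨z, Or.inl rfl, hz, hf⟩
    · exact ⟨z⁻¹, Or.inr rfl, hz.inv, hf⟩
  refine ⟨ζ, hζ, (hζ'.farPath_pow hg m fun i => h.trans (hf i)).trans ?_⟩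
  have h1 := hζ'.le_wlen_pow m
  have hm' := pow_mem hζ'.mem m
  have h2 := wlen_le_mul_add hm' hg
  have h3 := wlen_inv hg
  exact h3 ▸ FarPath.mul (inv_mem hg) (mul_mem hm' hg) (by omega)

/-- If, far along the direction `y`, the conjugate of `z` by `g` commutes with `z'`, then `g` can
be joined to a large power of `z'` or `z'⁻¹`. -/
lemma farPath_pow_of_commute {y z' : VPerm} {N : ℕ} (hN : 1 ≤ N) (hy : y ∈ S ∨ y⁻¹ ∈ S)
    (hy' : Undistorted S y) (hz : Undistorted S z) (hz' : Undistorted S z')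
    (hg : g ∈ Subgroup.closure S) (hgN : wlen S g ≤ N) (hr : r ≤ wlen S g)
    (hfar : ∀ i : ℕ, wlen S g ≤ 9 * wlen S (y ^ i * g))
    (hcomm : Commute ((y ^ (100 * N) * g)⁻¹ * z * (y ^ (100 * N) * g)) z') :
    ∃ ζ, (ζ = z' ∨ ζ = z'⁻¹) ∧ FarPath S r (15000 * N) g (ζ ^ (3000 * N)) := by
  set g' := y ^ (100 * N) * g with hg'
  have hyk := pow_mem hy'.mem (100 * N)
  have hgm : g' ∈ Subgroup.closure S := mul_mem hyk hg
  have p1 : FarPath S r (100 * N) g g' :=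
    farPath_pow_of_letter hy _ fun i => hr.trans (hfar i)
  have h1 : 100 * N ≤ wlen S g' + wlen S g :=
    (hy'.le_wlen_pow _).trans (wlen_le_mul_add hyk hg)
  have h2 : wlen S g' ≤ 100 * N + wlen S g := by
    have h := _root_.wlen_pow_le hy'.mem (100 * N)
    have h' := Nat.mul_le_mul_left (100 * N) (wlen_le_one hy)
    have h'' : wlen S g' ≤ _ := wlen_mul_le hyk hg
    omega
  obtain ⟨ζ, hζ, p2⟩ := hz.farPath_conj hgm (r := r) (m := 300 * N) (by omega) (by omega)
  set a := g'⁻¹ * (ζ ^ (300 * N) * g') with ha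
  have hζ' : Undistorted S ζ := by
    rcases hζ with rfl | rfl
    exacts [hz, hz.inv]
  have hζm := pow_mem hζ'.mem (300 * N)
  have ham : a ∈ Subgroup.closure S := mul_mem (inv_mem hgm) (mul_mem hζm hgm)
  have h3 : wlen S a ≤ wlen S g' + (300 * N * 4 + wlen S g') := by
    have h : wlen S a ≤ _ := wlen_mul_le (inv_mem hgm) (mul_mem hζm hgm)
    have h' := wlen_mul_le hζm hgm
    have h'' := hζ'.wlen_pow_le (300 * N)
    rw [wlen_inv hgm] at h
    omega
  have h4 : 300 * N ≤ wlen S a + wlen S g' + wlen S g' := by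
    have h := hζ'.le_wlen_pow (300 * N)
    have h' := wlen_le_mul_add hζm hgm
    have h'' : _ ≤ _ + wlen S a := wlen_le_add_mul (inv_mem hgm) (mul_mem hζm hgm)
    rw [wlen_inv hgm] at h''
    omega
  have hcomm' : Commute a z' := by
    have hconj : a = (g'⁻¹ * ζ * g') ^ (300 * N) := by
      rw [ha, ← mul_assoc]
      simpa using (conj_pow (a := g'⁻¹) (b := ζ) (i := 300 * N)).symm
    rw [hconj]
    refine Commute.pow_left ?_ _
    rcases hζ with rfl | rfl
    · exact hcomm
    · have : g'⁻¹ * z⁻¹ * g' = (g'⁻¹ * z * g')⁻¹ := by group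
      rw [this]
      exact hcomm.inv_left
  obtain ⟨ξ, hξ, p3⟩ := hz'.farPath_conj ham (r := r) (m := 3000 * N) (by omega) (by omega)
  refine ⟨ξ, hξ, ?_⟩
  have hξa : a⁻¹ * (ξ ^ (3000 * N) * a) = ξ ^ (3000 * N) := by
    have : Commute a ξ := by
      rcases hξ with rfl | rfl
      exacts [hcomm', hcomm'.inv_right]
    rw [← (this.pow_right _).eq, inv_mul_cancel_left]
  rw [hξa] at p3
  exact ((p1.trans p2).trans p3).mono (by omega)

end Undistorted

/-- Large powers of two elements generating an undistorted `ℤ²` are joined far from the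
identity. -/
lemma farPath_pow_pow {s t : VPerm} {r M : ℕ} (hs : Undistorted S s) (ht : Undistorted S t)
    (hst : Commute s t) (hr : r + 36 ≤ 9 * M)
    (h1 : ∀ i : ℕ, M ≤ wlen S (t ^ i * s ^ M)) (h2 : ∀ i : ℕ, M ≤ wlen S (s ^ i * t ^ M)) :
    FarPath S r (8 * M) (s ^ M) (t ^ M) := by
  have p := ht.farPath_pow (pow_mem hs.mem M) M (r := r) fun i => by
    have := h1 i; omega
  have q := hs.farPath_pow (pow_mem ht.mem M) M (r := r) fun i => by
    have := h2 i; omega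
  rw [(hst.pow_pow M M).eq] at q
  exact (p.trans q.symm).mono (by omega)

end WordLength

/-! ### Germs at the endpoints -/

/-- `g` maps `c^k ω` to `c^(k+e) ω` for all `k ≥ K`. -/
def GermAt (c : Bool) (g : VPerm) (K : ℕ) (e : ℤ) : Prop :=
  0 ≤ K + e ∧ ∀ k l : ℕ, K ≤ k → (l : ℤ) = k + e → ∀ ω, g (powApp c k ω) = powApp c l ω

namespace GermAt

variable {c : Bool} {g h : VPerm} {K K' : ℕ} {d e : ℤ}

lemma mono (hg : GermAt c g K e) (hK : K ≤ K') : GermAt c g K' e :=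
  ⟨by have := hg.1; omega, fun k l hk => hg.2 k l (hK.trans hk)⟩

lemma mul (hg : GermAt c g K e) (hh : GermAt c h K' d) (hK : (K : ℤ) ≤ K' + d) :
    GermAt c (g * h) K' (e + d) := by
  refine ⟨by have := hg.1; omega, fun k l hk hl ω => ?_⟩
  rw [Equiv.Perm.mul_apply, hh.2 k (k + d).toNat hk (by omega), hg.2 _ l (by omega) (by omega)]

lemma inv (hg : GermAt c g K e) (hK : (K : ℤ) + e ≤ K') : GermAt c g⁻¹ K' (-e) := by
  have := hg.1
  refine ⟨by omega, fun k l hk hl ω => inv_apply_of_apply_eq ?_⟩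
  exact hg.2 l k (by omega) (by omega) ω

lemma one : GermAt c 1 K 0 :=
  ⟨by omega, fun k l _ hl ω => by rw [show l = k by omega]; rfl⟩

lemma unique (h1 : GermAt c g K e) (h2 : GermAt c g K' d) : e = d := by
  have := h1.1
  have := h2.1
  have h := h1.2 (max K K') (max K K' + e).toNat (by omega) (by omega) (app [!c] zeros)
  rw [h2.2 (max K K') (max K K' + d).toNat (by omega) (by omega)] at h
  have := powApp_inj h
  omega

end GermAt

/-- `g` has some germ `c^k ω ↦ c^(k+e) ω` at the endpoint `ccc…`. -/
def Germ (c : Bool) (g : VPerm) (e : ℤ) : Prop := ∃ K, GermAt c g K e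

namespace Germ

variable {c : Bool} {g h : VPerm} {d e : ℤ}

lemma mul (hg : Germ c g e) (hh : Germ c h d) : Germ c (g * h) (e + d) := by
  obtain ⟨K, hg⟩ := hg
  obtain ⟨K', hh⟩ := hh
  exact ⟨_, hg.mul (hh.mono (le_max_left K' (K - d).toNat)) (by omega)⟩

lemma inv (hg : Germ c g e) : Germ c g⁻¹ (-e) := by
  obtain ⟨K, hg⟩ := hg
  exact ⟨(K + e).toNat, hg.inv (by omega)⟩

lemma pow (hg : Germ c g e) (n : ℕ) : Germ c (g ^ n) (n * e) := by
  induction n with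
  | zero => exact ⟨0, by simpa using GermAt.one⟩
  | succ n ih =>
    rw [pow_succ]
    convert ih.mul hg using 1
    push_cast; ring

end Germ

namespace IsGenPair

variable {x0 x1 : VPerm}

lemma germAt_false_x0 (hx : IsGenPair x0 x1) : GermAt false x0 2 (-1) := by
  refine ⟨by norm_num, fun k l hk hl ω => ?_⟩
  obtain ⟨k, rfl⟩ : ∃ j, k = j + 2 := ⟨k - 2, by omega⟩
  obtain rfl : l = k + 1 := by omega
  simp only [powApp_succ, hx.x0_00]

lemma germAt_true_x0 (hx : IsGenPair x0 x1) : GermAt true x0 1 1 := by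
  refine ⟨by norm_num, fun k l hk hl ω => ?_⟩
  obtain ⟨k, rfl⟩ : ∃ j, k = j + 1 := ⟨k - 1, by omega⟩
  obtain rfl : l = k + 2 := by omega
  simp only [powApp_succ, hx.x0_1]

lemma germAt_false_x1 (hx : IsGenPair x0 x1) : GermAt false x1 1 0 := by
  refine ⟨by norm_num, fun k l hk hl ω => ?_⟩
  obtain ⟨k, rfl⟩ : ∃ j, k = j + 1 := ⟨k - 1, by omega⟩
  obtain rfl : l = k + 1 := by omega
  simp only [powApp_succ, hx.x1_0]

lemma germAt_true_x1 (hx : IsGenPair x0 x1) : GermAt true x1 2 1 := by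
  refine ⟨by norm_num, fun k l hk hl ω => ?_⟩
  obtain ⟨k, rfl⟩ : ∃ j, k = j + 2 := ⟨k - 2, by omega⟩
  obtain rfl : l = k + 3 := by omega
  simp only [powApp_succ, hx.x1_1, hx.x0_1]

lemma exists_germAt_letter (hx : IsGenPair x0 x1) (c : Bool) {x : VPerm}
    (h : x ∈ ({x0, x1} : Set VPerm) ∨ x⁻¹ ∈ ({x0, x1} : Set VPerm)) :
    ∃ e : ℤ, |e| ≤ 1 ∧ GermAt c x 3 e := by
  have key : ∀ x ∈ ({x0, x1} : Set VPerm), ∃ (K : ℕ) (e : ℤ), |e| ≤ 1 ∧ K ≤ 3 ∧ K + e ≤ 3 ∧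
      GermAt c x K e := by
    rintro x (rfl | rfl) <;> cases c
    exacts [⟨2, -1, by norm_num, by norm_num, by norm_num, hx.germAt_false_x0⟩,
      ⟨1, 1, by norm_num, by norm_num, by norm_num, hx.germAt_true_x0⟩,
      ⟨1, 0, by norm_num, by norm_num, by norm_num, hx.germAt_false_x1⟩,
      ⟨2, 1, by norm_num, by norm_num, by norm_num, hx.germAt_true_x1⟩]
  rcases h with h | h
  · obtain ⟨K, e, he, hK, -, hg⟩ := key x h
    exact ⟨e, he, hg.mono hK⟩
  · obtain ⟨K, e, he, -, hK, hg⟩ := key _ h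
    exact ⟨-e, by rwa [abs_neg], by simpa using hg.inv (K' := 3) (by exact_mod_cast hK)⟩

lemma exists_germAt (hx : IsGenPair x0 x1) (c : Bool) {g : VPerm}
    (hg : g ∈ Subgroup.closure ({x0, x1} : Set VPerm)) :
    ∃ e : ℤ, |e| ≤ wlen {x0, x1} g ∧ GermAt c g (wlen {x0, x1} g + 2) e := by
  obtain ⟨l, hl, hlS, rfl⟩ := exists_word hg
  rw [← hl]
  clear hl hg
  induction l with
  | nil => exact ⟨0, by simp, GermAt.one⟩
  | cons x l ih =>
    simp only [List.mem_cons, forall_eq_or_imp] at hlS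
    obtain ⟨d, hd, hd'⟩ := hx.exists_germAt_letter c hlS.1
    obtain ⟨e, he, he'⟩ := ih hlS.2
    rw [abs_le] at hd he
    refine ⟨d + e, ?_, ?_⟩
    · rw [List.length_cons, abs_le]; push_cast; omega
    · rw [List.prod_cons, List.length_cons]
      exact hd'.mul (he'.mono (by omega)) (by push_cast; omega)

lemma abs_le_wlen (hx : IsGenPair x0 x1) {c : Bool} {g : VPerm} {e : ℤ} (h : Germ c g e)
    (hg : g ∈ Subgroup.closure ({x0, x1} : Set VPerm)) : |e| ≤ wlen {x0, x1} g := by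
  obtain ⟨K, hK⟩ := h
  obtain ⟨d, hd, hd'⟩ := hx.exists_germAt c hg
  rwa [hK.unique hd']

lemma undistorted (hx : IsGenPair x0 x1) {c : Bool} {z : VPerm} {e : ℤ}
    (hz : z ∈ Subgroup.closure ({x0, x1} : Set VPerm)) (h4 : wlen {x0, x1} z ≤ 4)
    (h : Germ c z e) (he : |e| = 1) : Undistorted {x0, x1} z where
  mem := hz
  wlen_le := h4
  le_wlen_pow i := by
    have := hx.abs_le_wlen (h.pow i) (pow_mem hz i)
    rw [abs_mul, he, mul_one] at this
    exact_mod_cast (le_abs_self _).trans this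

end IsGenPair

/-! ### Linear divergence of `F` -/

lemma inv_pow_apply_app {y : VPerm} {c : Bool}
    (hy : ∀ ω, y⁻¹ (app [c] ω) = app [c] (app [c] ω)) (k : ℕ) (ω : CSeq) :
    (y ^ k)⁻¹ (app [c] ω) = powApp c (k + 1) ω := by
  rw [← inv_pow]
  induction k with
  | zero => rw [pow_zero, powApp_succ, powApp_zero]; rfl
  | succ k ih => rw [pow_succ', Equiv.Perm.mul_apply, ih, powApp_succ, hy, ← powApp_succ,
      ← powApp_succ]

namespace IsGenPair

variable {x0 x1 : VPerm}

lemma commute_conj (hx : IsGenPair x0 x1) {y z z' g : VPerm} {c : Bool} {k : ℕ}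
    (hy : ∀ ω, y⁻¹ (app [c] ω) = app [c] (app [c] ω))
    (hz : ∀ ω, z (app [!c] ω) = app [!c] ω) (hz' : ∀ ω, z' (app [c] ω) = app [c] ω)
    (hg : g ∈ Subgroup.closure ({x0, x1} : Set VPerm)) (hk : wlen {x0, x1} g + 1 ≤ k) :
    Commute ((y ^ k * g)⁻¹ * z * (y ^ k * g)) z' := by
  refine Equiv.Perm.Disjoint.commute fun ω => ?_
  obtain ⟨d, ω, rfl⟩ := exists_app_singleton ω
  by_cases hd : d = c
  · exact Or.inr (hd ▸ hz' ω)
  left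
  obtain ⟨b, η, hη⟩ := exists_app_singleton ((y ^ k * g) (app [d] ω))
  by_cases hb : b = c
  · exfalso
    subst hb
    have h1 : g (app [d] ω) = powApp b (k + 1) η := by
      rw [← inv_pow_apply_app hy, ← hη, Equiv.Perm.mul_apply, Equiv.Perm.inv_def,
        Equiv.symm_apply_apply]
    obtain ⟨e, he, hge⟩ := hx.exists_germAt b (inv_mem hg)
    rw [wlen_inv hg] at he hge
    rw [abs_le] at he
    obtain ⟨l, hl⟩ : ∃ l : ℕ, ((l + 1 : ℕ) : ℤ) = (k + 1 : ℕ) + e :=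
      ⟨(k + e).toNat, by push_cast; omega⟩
    have h2 := inv_apply_of_apply_eq h1
    rw [hge.2 (k + 1) (l + 1) (by omega) hl, powApp_succ, app_singleton_inj] at h2
    exact hd h2.1.symm
  · obtain rfl : b = !c := by cases b <;> cases c <;> simp_all
    rw [Equiv.Perm.mul_apply, Equiv.Perm.mul_apply, hη, hz]
    exact inv_apply_of_apply_eq hη

lemma copyHom_false_x0_true (x0 : VPerm) (ω : CSeq) :
    copyHom false x0 (app [true] ω) = app [true] ω := copyHom_of_ne (by decide) _ _

lemma commute_x1_copyHom (hx : IsGenPair x0 x1) : Commute x1 (copyHom false x0) := by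
  refine Equiv.Perm.Disjoint.commute fun ω => ?_
  obtain ⟨c, ω, rfl⟩ := exists_app_singleton ω
  cases c
  · exact Or.inl (hx.x1_0 ω)
  · exact Or.inr (copyHom_false_x0_true x0 ω)

lemma germ_copyHom (hx : IsGenPair x0 x1) {c : Bool} {d e : ℤ} (h0 : Germ c x0 d)
    (h1 : Germ c x1 e) : Germ c (copyHom false x0) (d - e) := by
  rw [hx.copyHom_false_x0]
  convert ((h0.inv.mul h1.inv).mul h0).mul h0 using 1
  ring

lemma germ_false_copyHom (hx : IsGenPair x0 x1) : Germ false (copyHom false x0) (-1) :=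
  hx.germ_copyHom ⟨_, hx.germAt_false_x0⟩ ⟨_, hx.germAt_false_x1⟩

lemma germ_true_copyHom (hx : IsGenPair x0 x1) : Germ true (copyHom false x0) 0 :=
  hx.germ_copyHom ⟨_, hx.germAt_true_x0⟩ ⟨_, hx.germAt_true_x1⟩

lemma undistorted_x0 (hx : IsGenPair x0 x1) : Undistorted {x0, x1} x0 :=
  hx.undistorted x0_mem ((wlen_le_one (by simp)).trans (by norm_num))
    ⟨_, hx.germAt_true_x0⟩ (by norm_num)

lemma undistorted_x1 (hx : IsGenPair x0 x1) : Undistorted {x0, x1} x1 :=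
  hx.undistorted x1_mem ((wlen_le_one (by simp)).trans (by norm_num))
    ⟨_, hx.germAt_true_x1⟩ (by norm_num)

lemma undistorted_copyHom (hx : IsGenPair x0 x1) :
    Undistorted {x0, x1} (copyHom false x0) := by
  refine hx.undistorted hx.copyHom_false_x0_mem ?_ hx.germ_false_copyHom (by norm_num)
  have := wlen_prod_le (S := {x0, x1}) (l := [x0⁻¹, x1⁻¹, x0, x0]) (by simp)
  simpa [hx.copyHom_false_x0, mul_assoc] using this

lemma le_wlen_pow_mul_pow (hx : IsGenPair x0 x1) {c : Bool} {s t : VPerm} {e : ℤ}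
    (hs : Undistorted {x0, x1} s) (ht : Undistorted {x0, x1} t) (hes : Germ c s e)
    (he : |e| = 1) (het : Germ c t 0) (M i : ℕ) : M ≤ wlen {x0, x1} (t ^ i * s ^ M) := by
  have := hx.abs_le_wlen ((het.pow i).mul (hes.pow M))
    (mul_mem (pow_mem ht.mem i) (pow_mem hs.mem M))
  rw [mul_zero, zero_add, abs_mul, he, mul_one] at this
  exact_mod_cast (le_abs_self _).trans this

lemma farPath_pow_x1_pow_copyHom (hx : IsGenPair x0 x1) {s t : VPerm} {r M : ℕ}
    (hr : r + 36 ≤ 9 * M) (hs : s = x1 ∨ s = x1⁻¹)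
    (ht : t = copyHom false x0 ∨ t = (copyHom false x0)⁻¹) :
    FarPath {x0, x1} r (8 * M) (s ^ M) (t ^ M) := by
  obtain ⟨hsu, hs0, d, hd, hs1, hsc⟩ : Undistorted {x0, x1} s ∧ Germ false s 0 ∧
      ∃ d : ℤ, |d| = 1 ∧ Germ true s d ∧ Commute s (copyHom false x0) := by
    have h0 : Germ false x1 0 := ⟨_, hx.germAt_false_x1⟩
    have h1 : Germ true x1 1 := ⟨_, hx.germAt_true_x1⟩
    rcases hs with rfl | rfl
    · exact ⟨hx.undistorted_x1, h0, 1, by norm_num, h1, hx.commute_x1_copyHom⟩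
    · exact ⟨hx.undistorted_x1.inv, by simpa using h0.inv, -1, by norm_num, h1.inv,
        hx.commute_x1_copyHom.inv_left⟩
  obtain ⟨htu, ht1, e, he, ht0, htc⟩ : Undistorted {x0, x1} t ∧ Germ true t 0 ∧
      ∃ e : ℤ, |e| = 1 ∧ Germ false t e ∧ Commute s t := by
    rcases ht with rfl | rfl
    · exact ⟨hx.undistorted_copyHom, hx.germ_true_copyHom, -1, by norm_num,
        hx.germ_false_copyHom, hsc⟩
    · exact ⟨hx.undistorted_copyHom.inv, by simpa using hx.germ_true_copyHom.inv, 1,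
        by norm_num, by simpa using hx.germ_false_copyHom.inv, hsc.inv_right⟩
  exact farPath_pow_pow hsu htu htc hr (hx.le_wlen_pow_mul_pow hsu htu hs1 hd ht1 M)
    (hx.le_wlen_pow_mul_pow htu hsu ht0 he hs0 M)

/-- Every element can be joined, far from the identity, to a fixed large power of the copy of
`x0` on `[0]`. -/
lemma farPath_base (hx : IsGenPair x0 x1) {g : VPerm} {r N : ℕ} (hN : 1 ≤ N)
    (hg : g ∈ Subgroup.closure ({x0, x1} : Set VPerm)) (hgN : wlen {x0, x1} g ≤ N)
    (hr : r ≤ wlen {x0, x1} g) :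
    FarPath {x0, x1} r (63000 * N) g (copyHom false x0 ^ (3000 * N)) := by
  have hr' : r + 36 ≤ 9 * (3000 * N) := by omega
  rcases hx.undistorted_x0.far_or_far hg with hf | hf
  · obtain ⟨ζ, hζ, p⟩ := Undistorted.farPath_pow_of_commute hN (by simp) hx.undistorted_x0
      hx.undistorted_copyHom hx.undistorted_x1 hg hgN hr hf
      (hx.commute_conj (c := false) hx.x0_inv_0 (copyHom_false_x0_true x0) hx.x1_0 hg
        (by omega))
    exact (p.trans (hx.farPath_pow_x1_pow_copyHom hr' hζ (Or.inl rfl))).mono (by omega)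
  · obtain ⟨ζ, hζ, p⟩ := Undistorted.farPath_pow_of_commute hN (by simp) hx.undistorted_x0.inv
      hx.undistorted_x1 hx.undistorted_copyHom hg hgN hr hf
      (hx.commute_conj (c := true) (by simpa using hx.x0_1) hx.x1_0
        (copyHom_false_x0_true x0) hg (by omega))
    exact ((p.trans (hx.farPath_pow_x1_pow_copyHom hr' (Or.inl rfl) hζ).symm).trans
      (hx.farPath_pow_x1_pow_copyHom hr' (Or.inl rfl) (Or.inl rfl))).mono (by omega)

lemma exists_far_word (hx : IsGenPair x0 x1) {g1 g2 : VPerm}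
    (h1 : g1 ∈ Subgroup.closure ({x0, x1} : Set VPerm))
    (h2 : g2 ∈ Subgroup.closure ({x0, x1} : Set VPerm)) :
    ∃ w : List VPerm, (∀ x ∈ w, x ∈ ({x0, x1} : Set VPerm) ∨ x⁻¹ ∈ ({x0, x1} : Set VPerm)) ∧
      w.length ≤ 126000 * (wlen {x0, x1} g1 + wlen {x0, x1} g2) ∧ wordEval g1 w = g2 ∧
      ∀ w' : List VPerm, w' <+: w →
        min (wlen {x0, x1} g1) (wlen {x0, x1} g2) ≤ 9 * wlen {x0, x1} (wordEval g1 w') := by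
  rcases Nat.eq_zero_or_pos (wlen {x0, x1} g1 + wlen {x0, x1} g2) with h | h
  · obtain rfl := eq_one_of_wlen_eq_zero h1 (by omega)
    obtain rfl := eq_one_of_wlen_eq_zero h2 (by omega)
    exact ⟨[], by simp, by simp, rfl, fun w' _ => by simp [wlen_one]⟩
  · have p := hx.farPath_base h h1 (by omega) (min_le_left _ (wlen {x0, x1} g2))
    have q := hx.farPath_base h h2 (by omega) (min_le_right (wlen {x0, x1} g1) _)
    exact ((p.trans q.symm).mono (by omega)).exists_word

end IsGenPair

/-- There exist `δ, D > 0` such that for all `g1, g2 ∈ F`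
with `N(g1), N(g2) ≥ 4` there is a word `w` in the letters `x0^{±1}, x1^{±1}`
of length at most `D·(|g1|_A + |g2|_A)`, with `g1·w = g2` (left-to-right
products) and `|g1·w'|_A ≥ δ·min{|g1|_A, |g2|_A}` for every prefix `w'` of
`w`. -/
theorem stmt17 (x0 x1 : VPerm)
    (hx0 : Represents x0 x0T) (hx1 : Represents x1 x1T) :
    ∃ δ D : ℝ, 0 < δ ∧ 0 < D ∧
      ∀ g1 g2 : VPerm, InF g1 → InF g2 → 4 ≤ Nbr g1 → 4 ≤ Nbr g2 →
        ∃ w : List VPerm,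
          (∀ x ∈ w, x = x0 ∨ x = x0⁻¹ ∨ x = x1 ∨ x = x1⁻¹) ∧
          (w.length : ℝ) ≤ D * ((wlen {x0, x1} g1 : ℝ) + (wlen {x0, x1} g2 : ℝ)) ∧
          wordEval g1 w = g2 ∧
          (∀ w' : List VPerm, w' <+: w →
            δ * min (wlen {x0, x1} g1 : ℝ) (wlen {x0, x1} g2 : ℝ) ≤
              (wlen {x0, x1} (wordEval g1 w') : ℝ)) := by
  have hx := isGenPair_of_represents hx0 hx1
  refine ⟨1 / 9, 126000, by norm_num, by norm_num, fun g1 g2 hg1 hg2 _ _ => ?_⟩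
  obtain ⟨w, hw, hl, he, hp⟩ := hx.exists_far_word (hx.mem_closure_of_inF hg1)
    (hx.mem_closure_of_inF hg2)
  refine ⟨w, fun x hxw => ?_, by exact_mod_cast hl, he, fun w' hw' => ?_⟩
  · have := hw x hxw
    simp only [Set.mem_insert_iff, Set.mem_singleton_iff, inv_eq_iff_eq_inv] at this
    tauto
  · have h : (min (wlen {x0, x1} g1 : ℝ) (wlen {x0, x1} g2 : ℝ)) ≤
        9 * (wlen {x0, x1} (wordEval g1 w') : ℝ) := by exact_mod_cast hp w' hw'
    linarith
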